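/- arXiv:2605.20028 — 3 statements merged into one kernel-verified Lean document; each statement's English description precedes it below -/
import Mathlib

section
/- Let μ be a probability measure on ℝⁿ with finite second moment, let α ≠ 0 and σ > 0, and define the smoothed density p(x_t) = ∫ (2πσ²)^{−n/2} exp(−‖x_t − αx‖²/(2σ²)) dμ(x), the posterior mean m(x_t) = p(x_t)^{−1} ∫ x (2πσ²)^{−n/2} exp(−‖x_t − αx‖²/(2σ²)) dμ(x), the posterior second moment M₂(x_t) = p(x_t)^{−1} ∫ x xᵀ (2πσ²)^{−n/2} exp(−‖x_t − αx‖²/(2σ²)) dμ(x), and the posterior covariance V(x_t) = M₂(x_t) − m(x_t) m(x_t)ᵀ. Then the map x_t ↦ m(x_t) is differentiable and its Jacobian matrix satisfies D m(x_t) = (α/σ²) V(x_t) for every x_t ∈ ℝⁿ. -/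
open MeasureTheory Real

section GaussianKernel

lemma gaussian_kernel_le {E : Type*} [NormedAddCommGroup E] {C : ℝ} (hC : 0 ≤ C) (s : ℝ) (w : E) :
    C * Real.exp (-‖w‖ ^ 2 / (2 * s ^ 2)) ≤ C := by
  refine mul_le_of_le_one_right hC (Real.exp_le_one_iff.2 ?_)
  exact div_nonpos_of_nonpos_of_nonneg (by simp) (by positivity)

variable {E F : Type*} [NormedAddCommGroup E] [InnerProductSpace ℝ E]
  [NormedAddCommGroup F] [NormedSpace ℝ F]

lemma hasFDerivAt_gaussian_kernel (C s : ℝ) (c y : E) :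
    HasFDerivAt (fun z : E => C * Real.exp (-‖z - c‖ ^ 2 / (2 * s ^ 2)))
      ((-(C * Real.exp (-‖y - c‖ ^ 2 / (2 * s ^ 2))) / s ^ 2) • innerSL ℝ (y - c)) y := by
  have h1 : HasFDerivAt (fun z : E => ‖z - c‖ ^ 2) (2 • innerSL ℝ (y - c)) y := by
    simpa using ((hasFDerivAt_id y).sub_const c).norm_sq
  have h2 : HasFDerivAt (fun z : E => -‖z - c‖ ^ 2 / (2 * s ^ 2))
      ((-(2 * s ^ 2)⁻¹) • (2 • innerSL ℝ (y - c))) y := by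
    refine (h1.const_mul (-(2 * s ^ 2)⁻¹)).congr_of_eventuallyEq (.of_forall fun z => ?_)
    simp only [div_eq_mul_inv]
    ring
  refine (h2.exp.const_mul C).congr_fderiv ?_
  ext v
  simp only [smul_apply, smul_eq_mul, nsmul_eq_mul, mul_inv, div_eq_mul_inv]
  push_cast
  ring

variable [MeasurableSpace E] [BorelSpace E]

lemma integrable_gaussian_kernel_smul {μ : Measure E} {C : ℝ} (hC : 0 ≤ C) (a s : ℝ)
    {f : E → F} (hf : Integrable f μ) (y : E) :
    Integrable (fun x => (C * Real.exp (-‖y - a • x‖ ^ 2 / (2 * s ^ 2))) • f x) μ := by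
  refine hf.bdd_smul C (Continuous.aestronglyMeasurable (by fun_prop))
    (.of_forall fun x => ?_)
  rw [Real.norm_of_nonneg (by positivity)]
  exact gaussian_kernel_le hC s _

/-- Gaussian smoothing of an integrable `f` with integrable first moment can be differentiated
under the integral sign. -/
lemma hasFDerivAt_integral_gaussian_kernel_smul [SecondCountableTopology E]
    {μ : Measure E} {C : ℝ} (hC : 0 ≤ C) (a s : ℝ)
    {f : E → F} (hf : Integrable f μ) (hxf : Integrable (fun x => ‖x‖ * ‖f x‖) μ) (y : E) :
    let K' : E → E →L[ℝ] F := fun x =>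
      ((-(C * Real.exp (-‖y - a • x‖ ^ 2 / (2 * s ^ 2))) / s ^ 2) •
        innerSL ℝ (y - a • x)).smulRight (f x)
    Integrable K' μ ∧
      HasFDerivAt (fun z => ∫ x, (C * Real.exp (-‖z - a • x‖ ^ 2 / (2 * s ^ 2))) • f x ∂μ)
        (∫ x, K' x ∂μ) y := by
  intro K'
  have hmeas : AEStronglyMeasurable K' μ := by
    have hg : Continuous fun x : E =>
        (-(C * Real.exp (-‖y - a • x‖ ^ 2 / (2 * s ^ 2))) / s ^ 2) • innerSL ℝ (y - a • x) := by
      fun_prop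
    exact (ContinuousLinearMap.smulRightL ℝ E F).aestronglyMeasurable_comp₂
      hg.aestronglyMeasurable hf.aestronglyMeasurable
  have hbound : ∀ x, ∀ z ∈ Metric.ball y 1,
      ‖((-(C * Real.exp (-‖z - a • x‖ ^ 2 / (2 * s ^ 2))) / s ^ 2) •
        innerSL ℝ (z - a • x)).smulRight (f x)‖ ≤
        C / s ^ 2 * ((‖y‖ + 1) * ‖f x‖ + |a| * (‖x‖ * ‖f x‖)) := by
    intro x z hz
    have hz' : ‖z‖ ≤ ‖y‖ + 1 := by
      have := norm_le_norm_add_norm_sub' z y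
      rw [mem_ball_iff_norm] at hz
      linarith
    have hza : ‖z - a • x‖ ≤ ‖y‖ + 1 + |a| * ‖x‖ := by
      refine (norm_sub_le _ _).trans ?_
      rw [norm_smul, Real.norm_eq_abs]
      linarith
    rw [ContinuousLinearMap.norm_smulRight_apply, norm_smul, innerSL_apply_norm, norm_div, norm_neg,
      Real.norm_of_nonneg (by positivity : 0 ≤ C * _), Real.norm_of_nonneg (sq_nonneg s)]
    calc _ ≤ C / s ^ 2 * (‖y‖ + 1 + |a| * ‖x‖) * ‖f x‖ := by
          gcongr
          exact gaussian_kernel_le hC s _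
      _ = _ := by ring
  have hbi : Integrable
      (fun x => C / s ^ 2 * ((‖y‖ + 1) * ‖f x‖ + |a| * (‖x‖ * ‖f x‖))) μ :=
    ((hf.norm.const_mul _).add (hxf.const_mul _)).const_mul _
  refine ⟨hbi.mono' hmeas (.of_forall fun x => hbound x y (Metric.mem_ball_self one_pos)), ?_⟩
  refine hasFDerivAt_integral_of_dominated_of_fderiv_le (Metric.ball_mem_nhds y one_pos)
    (.of_forall fun z => (integrable_gaussian_kernel_smul hC a s hf z).aestronglyMeasurable)
    (integrable_gaussian_kernel_smul hC a s hf y) hmeas (.of_forall hbound) hbi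
    (.of_forall fun x z _ => ?_)
  exact (hasFDerivAt_gaussian_kernel C s (a • x) z).smul_const (f x)

end GaussianKernel

/-- **Jacobian of the posterior mean (first-order Tweedie, differentiated).**
If `μ` is a probability measure on `ℝⁿ` with finite second moment, `α ≠ 0`, `σ > 0`,
`K xt x = (2πσ²)^(−n/2) exp(−‖xt − αx‖²/(2σ²))` is the Gaussian kernel,
`p(x_t) = ∫ K(x_t, x) dμ(x)` the smoothed density,
`m(x_t) = p(x_t)⁻¹ ∫ x K(x_t, x) dμ(x)` the posterior mean,
`M₂(x_t) = p(x_t)⁻¹ ∫ x xᵀ K(x_t, x) dμ(x)` the posterior second moment and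
`V(x_t) = M₂(x_t) − m(x_t) m(x_t)ᵀ` the posterior covariance, then `m` is differentiable
with Jacobian `D m(x_t) = (α/σ²) V(x_t)` for every `x_t`. -/
theorem tweedie_posterior_mean_jacobian
    (n : ℕ) (μ : Measure (EuclideanSpace ℝ (Fin n))) [IsProbabilityMeasure μ]
    (hμ2 : Integrable (fun x => ‖x‖ ^ 2) μ)
    (α σ : ℝ) (hα : α ≠ 0) (hσ : 0 < σ)
    (K : EuclideanSpace ℝ (Fin n) → EuclideanSpace ℝ (Fin n) → ℝ)
    (hK : ∀ xt x, K xt x = (2 * π * σ ^ 2) ^ (-(n : ℝ) / 2) *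
      Real.exp (-‖xt - α • x‖ ^ 2 / (2 * σ ^ 2)))
    (p : EuclideanSpace ℝ (Fin n) → ℝ)
    (hp : ∀ xt, p xt = ∫ x, K xt x ∂μ)
    (m : EuclideanSpace ℝ (Fin n) → EuclideanSpace ℝ (Fin n))
    (hm : ∀ xt, m xt = (p xt)⁻¹ • ∫ x, K xt x • x ∂μ)
    (M₂ : EuclideanSpace ℝ (Fin n) → Matrix (Fin n) (Fin n) ℝ)
    (hM₂ : ∀ xt i j, M₂ xt i j = (p xt)⁻¹ * ∫ x, K xt x * (x i * x j) ∂μ)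
    (V : EuclideanSpace ℝ (Fin n) → Matrix (Fin n) (Fin n) ℝ)
    (hV : ∀ xt i j, V xt i j = M₂ xt i j - m xt i * m xt j) :
    Differentiable ℝ m ∧
      ∀ xt i j, fderiv ℝ m xt (EuclideanSpace.single j 1) i
        = (α / σ ^ 2) * V xt i j := by
  obtain rfl : K = fun xt x => (2 * π * σ ^ 2) ^ (-(n : ℝ) / 2) *
      Real.exp (-‖xt - α • x‖ ^ 2 / (2 * σ ^ 2)) := by
    funext xt x
    exact hK xt x
  clear hK
  have hC0 : 0 < (2 * π * σ ^ 2) ^ (-(n : ℝ) / 2) := by positivity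
  generalize (2 * π * σ ^ 2) ^ (-(n : ℝ) / 2) = C at *
  have hid : Integrable (fun x : EuclideanSpace ℝ (Fin n) => x) μ := by
    have : MemLp (fun x : EuclideanSpace ℝ (Fin n) => x) 2 μ :=
      (memLp_two_iff_integrable_sq_norm continuous_id.aestronglyMeasurable).2 hμ2
    exact this.integrable one_le_two
  have hone : Integrable (fun _ : EuclideanSpace ℝ (Fin n) => (1 : ℝ)) μ := integrable_const 1
  have hxx : ∀ i j, Integrable (fun x : EuclideanSpace ℝ (Fin n) => x i * x j) μ := by
    intro i j
    refine hμ2.mono' (Continuous.aestronglyMeasurable (by fun_prop)) (.of_forall fun x => ?_)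
    rw [norm_mul, sq]
    gcongr <;> exact PiLp.norm_apply_le x _
  have hcoord : ∀ i, Integrable (fun x : EuclideanSpace ℝ (Fin n) => x i) μ := fun i =>
    (EuclideanSpace.proj (𝕜 := ℝ) i).integrable_comp hid
  have iK := fun y => integrable_gaussian_kernel_smul hC0.le α σ hone y
  have iKx := fun y => integrable_gaussian_kernel_smul hC0.le α σ hid y
  have iKc := fun y i => integrable_gaussian_kernel_smul hC0.le α σ (hcoord i) y
  have iKxx := fun y i j => integrable_gaussian_kernel_smul hC0.le α σ (hxx i j) y
  simp only [smul_eq_mul, mul_one] at iK iKc iKxx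
  have hp0 : ∀ y, p y ≠ 0 := by
    intro y
    rw [hp]
    refine ((integral_pos_iff_support_of_nonneg (fun x => by positivity) (iK y)).2 ?_).ne'
    have : Function.support (fun x : EuclideanSpace ℝ (Fin n) =>
        C * Real.exp (-‖y - α • x‖ ^ 2 / (2 * σ ^ 2))) = Set.univ := by
      ext x
      simp [hC0.ne']
    simp [this]
  have hdp := fun y => hasFDerivAt_integral_gaussian_kernel_smul hC0.le α σ hone
    (by simpa using hid.norm) y
  have hdq := fun y => hasFDerivAt_integral_gaussian_kernel_smul hC0.le α σ hid
    (by simpa [sq] using hμ2) y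
  simp only [smul_eq_mul, mul_one, ← hp] at hdp
  have hq_apply : ∀ y i, (∫ x, (C * Real.exp (-‖y - α • x‖ ^ 2 / (2 * σ ^ 2))) • x ∂μ) i =
      ∫ x, C * Real.exp (-‖y - α • x‖ ^ 2 / (2 * σ ^ 2)) * x i ∂μ := by
    intro y i
    simpa using ((EuclideanSpace.proj (𝕜 := ℝ) i).integral_comp_comm (iKx y)).symm
  have hm' : m = fun y => (p y)⁻¹ • ∫ x, (C * Real.exp (-‖y - α • x‖ ^ 2 / (2 * σ ^ 2))) • x ∂μ :=
    funext hm
  have hdm := fun y => ((hasDerivAt_inv (hp0 y)).comp_hasFDerivAt y (hdp y).2).smul (hdq y).2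
  replace hdm := fun y => (hdm y).congr_of_eventuallyEq (.of_forall fun z => congrFun hm' z)
  refine ⟨fun y => (hdm y).differentiableAt, fun y i j => ?_⟩
  have hp' : (∫ x, ((-(C * Real.exp (-‖y - α • x‖ ^ 2 / (2 * σ ^ 2))) / σ ^ 2) •
      innerSL ℝ (y - α • x)).smulRight (1 : ℝ) ∂μ) (EuclideanSpace.single j 1) =
      -(y j / σ ^ 2) * p y +
        α / σ ^ 2 * ∫ x, C * Real.exp (-‖y - α • x‖ ^ 2 / (2 * σ ^ 2)) * x j ∂μ := by
    rw [ContinuousLinearMap.integral_apply (hdp y).1, hp, ← integral_const_mul,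
      ← integral_const_mul, ← integral_add ((iK y).const_mul _) ((iKc y j).const_mul _)]
    congr with x
    simp [EuclideanSpace.inner_single_right]
    ring
  have hq' : (∫ x, ((-(C * Real.exp (-‖y - α • x‖ ^ 2 / (2 * σ ^ 2))) / σ ^ 2) •
      innerSL ℝ (y - α • x)).smulRight x ∂μ) (EuclideanSpace.single j 1) i =
      -(y j / σ ^ 2) * ∫ x, C * Real.exp (-‖y - α • x‖ ^ 2 / (2 * σ ^ 2)) * x i ∂μ +
        α / σ ^ 2 * ∫ x, C * Real.exp (-‖y - α • x‖ ^ 2 / (2 * σ ^ 2)) * (x i * x j) ∂μ := by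
    rw [ContinuousLinearMap.integral_apply (hdq y).1]
    have := (EuclideanSpace.proj (𝕜 := ℝ) i).integral_comp_comm
      ((hdq y).1.apply_continuousLinearMap (EuclideanSpace.single j 1))
    refine this.symm.trans ?_
    rw [ ← integral_const_mul,
      ← integral_const_mul, ← integral_add ((iKc y i).const_mul _) ((iKxx y i j).const_mul _)]
    congr with x
    simp [EuclideanSpace.inner_single_right]
    ring
  have hp0y := hp0 y
  rw [(hdm y).fderiv, hV, hM₂, hm, PiLp.smul_apply, PiLp.smul_apply, hq_apply, hq_apply]
  simp only [add_apply, smul_apply,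
    ContinuousLinearMap.smulRight_apply, PiLp.add_apply, PiLp.smul_apply, smul_eq_mul,
    Function.comp_apply, hp', hq', hq_apply]
  field_simp
  ring
end

section
/- Let μ be a probability measure on ℝⁿ with finite second moment, let α ≠ 0 and σ > 0, and define the smoothed density p(x_t) = ∫ (2πσ²)^{−n/2} exp(−‖x_t − αx‖²/(2σ²)) dμ(x), the posterior mean m(x_t) = p(x_t)^{−1} ∫ x (2πσ²)^{−n/2} exp(−‖x_t − αx‖²/(2σ²)) dμ(x), and the posterior covariance V(x_t) = p(x_t)^{−1} ∫ x xᵀ (2πσ²)^{−n/2} exp(−‖x_t − αx‖²/(2σ²)) dμ(x) − m(x_t) m(x_t)ᵀ. Then log p is twice differentiable and its Hessian satisfies (second-order Tweedie formula) ∇²_{x_t} log p(x_t) = (α²/σ⁴) V(x_t) − σ^{−2} I for every x_t ∈ ℝⁿ; equivalently, V(x_t) = (σ²/α²)(σ² ∇²_{x_t} log p(x_t) + I). -/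
open MeasureTheory Real

/-- The isotropic Gaussian kernel with mean `α • x` and scale `σ`, up to the constant `c`. -/
noncomputable def gaussianKernel {E : Type*} [NormedAddCommGroup E] [NormedSpace ℝ E]
    (c α σ : ℝ) (z x : E) : ℝ :=
  c * Real.exp (-‖z - α • x‖ ^ 2 / (2 * σ ^ 2))

section gaussianKernel

variable {E F : Type*} [NormedAddCommGroup E] [InnerProductSpace ℝ E]
  [NormedAddCommGroup F] [NormedSpace ℝ F]

lemma abs_gaussianKernel_le (c α σ : ℝ) (z x : E) : |gaussianKernel c α σ z x| ≤ |c| := by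
  rw [gaussianKernel, abs_mul, Real.abs_exp]
  refine mul_le_of_le_one_right (abs_nonneg c) (Real.exp_le_one_iff.2 ?_)
  rw [neg_div]
  exact neg_nonpos.2 (by positivity)

lemma continuous_gaussianKernel (c α σ : ℝ) (z : E) : Continuous (gaussianKernel c α σ z) := by
  unfold gaussianKernel
  fun_prop

lemma hasFDerivAt_gaussianKernel (c α : ℝ) {σ : ℝ} (hσ : σ ≠ 0) (z x : E) :
    HasFDerivAt (fun z => gaussianKernel c α σ z x)
      (gaussianKernel c α σ z x • (-(σ ^ 2)⁻¹) • innerSL ℝ (z - α • x)) z := by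
  have h : HasFDerivAt (fun z : E => ‖z - α • x‖ ^ 2) (2 • innerSL ℝ (z - α • x)) z := by
    simpa using ((hasFDerivAt_id z).sub_const (α • x)).norm_sq
  have h2 := (((h.neg.mul_const (2 * σ ^ 2)⁻¹).exp).const_mul c)
  simp only [gaussianKernel, div_eq_mul_inv]
  refine h2.congr_fderiv ?_
  ext v
  simp
  field_simp

variable [MeasurableSpace E] [BorelSpace E] {μ : Measure E}

lemma integrable_gaussianKernel_smul (c α σ : ℝ) (z : E) {g : E → F} (hg : Integrable g μ) :
    Integrable (fun x => gaussianKernel c α σ z x • g x) μ :=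
  hg.bdd_smul |c| (continuous_gaussianKernel c α σ z).aestronglyMeasurable
    (Filter.Eventually.of_forall fun x => abs_gaussianKernel_le c α σ z x)

lemma integrable_inner_smul {g : E → F} (hg : Integrable g μ)
    (hg' : Integrable (fun x => ‖x‖ * ‖g x‖) μ) (v : E) :
    Integrable (fun x => inner ℝ x v • g x) μ := by
  refine (hg'.const_mul ‖v‖).mono' ?_ (Filter.Eventually.of_forall fun x => ?_)
  · exact (by fun_prop : Continuous fun x : E => inner ℝ x v).aestronglyMeasurable.smul
      hg.aestronglyMeasurable
  · rw [norm_smul]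
    nlinarith [mul_le_mul_of_nonneg_right (norm_inner_le_norm (𝕜 := ℝ) x v) (norm_nonneg (g x))]

/-- Differentiation under the integral sign for Gaussian smoothing of a function with finite
first moment. -/
lemma exists_hasFDerivAt_integral_gaussianKernel [SecondCountableTopology E] (c α : ℝ)
    {σ : ℝ} (hσ : σ ≠ 0) {g : E → F} (hg : Integrable g μ) (hg' : Integrable (fun x => ‖x‖ * ‖g x‖) μ) (z : E) :
    ∃ f' : E →L[ℝ] F,
      HasFDerivAt (fun z => ∫ x, gaussianKernel c α σ z x • g x ∂μ) f' z ∧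
      ∀ v, f' v = (σ ^ 2)⁻¹ • (α • ∫ x, gaussianKernel c α σ z x • inner ℝ x v • g x ∂μ
        - inner ℝ z v • ∫ x, gaussianKernel c α σ z x • g x ∂μ) := by
  set D : E → E → E →L[ℝ] F := fun w x =>
    (gaussianKernel c α σ w x • (-(σ ^ 2)⁻¹) • innerSL ℝ (w - α • x)).smulRight (g x) with hD
  set b : E → ℝ := fun x =>
    |c| * (σ ^ 2)⁻¹ * ((‖z‖ + 1) * ‖g x‖ + |α| * (‖x‖ * ‖g x‖)) with hb
  have hbint : Integrable b μ := ((hg.norm.const_mul _).add (hg'.const_mul _)).const_mul _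
  have hbound : ∀ x, ∀ w ∈ Metric.ball z 1, ‖D w x‖ ≤ b x := by
    intro x w hw
    have hw' : ‖w‖ ≤ ‖z‖ + 1 := by
      have := norm_le_norm_add_norm_sub' w z
      rw [Metric.mem_ball, dist_eq_norm] at hw
      linarith
    have h1 : ‖w - α • x‖ ≤ ‖z‖ + 1 + |α| * ‖x‖ := by
      have := norm_sub_le w (α • x)
      rw [norm_smul, Real.norm_eq_abs] at this
      linarith
    calc ‖D w x‖
        = |gaussianKernel c α σ w x| * (σ ^ 2)⁻¹ * ‖w - α • x‖ * ‖g x‖ := by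
          simp only [hD, ContinuousLinearMap.norm_smulRight_apply, norm_smul, norm_neg,
            innerSL_apply_norm, Real.norm_eq_abs, abs_inv, abs_pow, sq_abs]
          ring
      _ ≤ |c| * (σ ^ 2)⁻¹ * (‖z‖ + 1 + |α| * ‖x‖) * ‖g x‖ := by
          have := abs_gaussianKernel_le c α σ w x
          gcongr ?_ * _ * ?_ * _
      _ = b x := by simp only [hb]; ring
  have hDmeas : AEStronglyMeasurable (D z) μ := by
    have hk := continuous_gaussianKernel c α σ z
    have h1 : Continuous fun x : E =>
        gaussianKernel c α σ z x • (-(σ ^ 2)⁻¹) • innerSL ℝ (z - α • x) := by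
      fun_prop
    exact (ContinuousLinearMap.smulRightL ℝ E F).aestronglyMeasurable_comp₂
      h1.aestronglyMeasurable hg.aestronglyMeasurable
  have hDint : Integrable (D z) μ := hbint.mono' hDmeas
    (Filter.Eventually.of_forall fun x => hbound x z (Metric.mem_ball_self one_pos))
  refine ⟨∫ x, D z x ∂μ, ?_, fun v => ?_⟩
  · refine hasFDerivAt_integral_of_dominated_of_fderiv_le (bound := b)
      (Metric.ball_mem_nhds z one_pos)
      (Filter.Eventually.of_forall fun w =>
        (integrable_gaussianKernel_smul c α σ w hg).aestronglyMeasurable)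
      (integrable_gaussianKernel_smul c α σ z hg) hDmeas
      (Filter.Eventually.of_forall hbound) hbint
      (Filter.Eventually.of_forall fun x w _ =>
        (hasFDerivAt_gaussianKernel c α hσ w x).smul_const (g x))
  · rw [ContinuousLinearMap.integral_apply hDint, ← integral_smul, ← integral_smul,
      ← integral_sub, ← integral_smul]
    · refine integral_congr_ae (Filter.Eventually.of_forall fun x => ?_)
      simp only [hD, ContinuousLinearMap.smulRight_apply, _root_.smul_apply,
        innerSL_apply_apply, inner_sub_left, real_inner_smul_left]
      module
    · exact (integrable_gaussianKernel_smul c α σ z (integrable_inner_smul hg hg' v)).smul α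
    · exact (integrable_gaussianKernel_smul c α σ z hg).smul _

end gaussianKernel

/-- **Second-order Tweedie formula.** If `μ` is a probability measure on `ℝⁿ` with finite
second moment, `α ≠ 0`, `σ > 0`, `K xt x = (2πσ²)^(−n/2) exp(−‖xt − αx‖²/(2σ²))`,
`p(x_t) = ∫ K(x_t, x) dμ(x)`, `m(x_t) = p(x_t)⁻¹ ∫ x K(x_t, x) dμ(x)` and
`V(x_t) = p(x_t)⁻¹ ∫ x xᵀ K(x_t, x) dμ(x) − m(x_t) m(x_t)ᵀ`, then `log p` is twice
differentiable with Hessian `∇² log p(x_t) = (α²/σ⁴) V(x_t) − σ⁻² I`, equivalently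
`V(x_t) = (σ²/α²)(σ² ∇² log p(x_t) + I)`, for every `x_t`. The Hessian entry `(i,j)` is the
`j`-th partial derivative of the `i`-th component of the gradient of `log p`. -/
theorem tweedie_second_order
    (n : ℕ) (μ : Measure (EuclideanSpace ℝ (Fin n))) [IsProbabilityMeasure μ]
    (hμ2 : Integrable (fun x => ‖x‖ ^ 2) μ)
    (α σ : ℝ) (hα : α ≠ 0) (hσ : 0 < σ)
    (K : EuclideanSpace ℝ (Fin n) → EuclideanSpace ℝ (Fin n) → ℝ)
    (hK : ∀ xt x, K xt x = (2 * π * σ ^ 2) ^ (-(n : ℝ) / 2) *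
      Real.exp (-‖xt - α • x‖ ^ 2 / (2 * σ ^ 2)))
    (p : EuclideanSpace ℝ (Fin n) → ℝ)
    (hp : ∀ xt, p xt = ∫ x, K xt x ∂μ)
    (m : EuclideanSpace ℝ (Fin n) → EuclideanSpace ℝ (Fin n))
    (hm : ∀ xt, m xt = (p xt)⁻¹ • ∫ x, K xt x • x ∂μ)
    (V : EuclideanSpace ℝ (Fin n) → Matrix (Fin n) (Fin n) ℝ)
    (hV : ∀ xt i j, V xt i j
      = (p xt)⁻¹ * ∫ x, K xt x * (x i * x j) ∂μ - m xt i * m xt j) :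
    Differentiable ℝ (fun z => Real.log (p z)) ∧
    Differentiable ℝ (gradient fun z => Real.log (p z)) ∧
    (∀ xt i j, fderiv ℝ (gradient fun z => Real.log (p z)) xt
        (EuclideanSpace.single j 1) i
      = α ^ 2 / σ ^ 4 * V xt i j - (if i = j then (σ ^ 2)⁻¹ else 0)) ∧
    (∀ xt i j, V xt i j
      = σ ^ 2 / α ^ 2 *
        (σ ^ 2 * fderiv ℝ (gradient fun z => Real.log (p z)) xt
            (EuclideanSpace.single j 1) i
          + (if i = j then 1 else 0))) := by
  have hσ0 : σ ≠ 0 := hσ.ne'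
  set c : ℝ := (2 * π * σ ^ 2) ^ (-(n : ℝ) / 2)
  have hKG : ∀ z x, K z x = gaussianKernel c α σ z x := hK
  have hid : Integrable (fun x : EuclideanSpace ℝ (Fin n) => x) μ :=
    ((memLp_two_iff_integrable_sq_norm aestronglyMeasurable_id).2 hμ2).integrable one_le_two
  have hsq : Integrable (fun x : EuclideanSpace ℝ (Fin n) => ‖x‖ * ‖x‖) μ := by
    simpa only [sq] using hμ2
  set M : EuclideanSpace ℝ (Fin n) → EuclideanSpace ℝ (Fin n) :=
    fun z => ∫ x, gaussianKernel c α σ z x • x ∂μ with hM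
  have hpG : p = fun z => ∫ x, gaussianKernel c α σ z x • (1 : ℝ) ∂μ := by
    funext z
    simp [hp, hKG]
  have hmM : ∀ z, m z = (p z)⁻¹ • M z := fun z => by simp only [hm, hKG, hM]
  have hKint : ∀ z, Integrable (fun x => gaussianKernel c α σ z x) μ := fun z => by
    simpa using integrable_gaussianKernel_smul c α σ z (integrable_const (1 : ℝ))
  have hp0 : ∀ z, p z ≠ 0 := fun z => by
    have hc0 : 0 < c := by positivity
    have h : 0 < ∫ x, gaussianKernel c α σ z x ∂μ := by
      rw [integral_pos_iff_support_of_nonneg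
        (f := gaussianKernel c α σ z) (fun x => mul_nonneg hc0.le (Real.exp_pos _).le) (hKint z)]
      have : Function.support (gaussianKernel c α σ z) = Set.univ :=
        Set.eq_univ_of_forall fun x => (mul_pos hc0 (Real.exp_pos _)).ne'
      simp [this]
    simpa [hp, hKG] using h.ne'
  have hp' : ∀ z, HasFDerivAt p (((σ ^ 2)⁻¹ * p z) • innerSL ℝ (α • m z - z)) z := fun z => by
    obtain ⟨f', hf, hf'⟩ := exists_hasFDerivAt_integral_gaussianKernel (μ := μ) c α hσ0
      (integrable_const (1 : ℝ)) (by simpa using hid.norm) z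
    rw [← hpG] at hf
    refine hf.congr_fderiv (ContinuousLinearMap.ext fun v => ?_)
    have hin : ∫ x, gaussianKernel c α σ z x • inner ℝ x v • (1 : ℝ) ∂μ = inner ℝ (M z) v := by
      rw [real_inner_comm, ← integral_inner (integrable_gaussianKernel_smul c α σ z hid)]
      refine integral_congr_ae (Filter.Eventually.of_forall fun x => ?_)
      simp [real_inner_smul_right, real_inner_comm]
    have hpz : ∫ x, gaussianKernel c α σ z x • (1 : ℝ) ∂μ = p z := by rw [hpG]
    rw [hf', hin, hpz]
    have := hp0 z
    simp only [hmM, _root_.smul_apply, innerSL_apply_apply, inner_sub_left,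
      real_inner_smul_left, smul_eq_mul]
    field_simp
  have hlog : ∀ z, HasGradientAt (fun z => Real.log (p z)) ((σ ^ 2)⁻¹ • (α • m z - z)) z :=
    fun z => by
      rw [hasGradientAt_iff_hasFDerivAt]
      refine ((hp' z).log (hp0 z)).congr_fderiv (ContinuousLinearMap.ext fun v => ?_)
      have := hp0 z
      simp only [_root_.smul_apply, innerSL_apply_apply, smul_eq_mul,
        InnerProductSpace.toDual_apply_apply, real_inner_smul_left]
      field_simp
  have hgrad : gradient (fun z => Real.log (p z)) = fun z => (σ ^ 2)⁻¹ • (α • m z - z) :=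
    funext fun z => (hlog z).gradient
  have hm' : ∀ z, ∃ m' : EuclideanSpace ℝ (Fin n) →L[ℝ] EuclideanSpace ℝ (Fin n),
      HasFDerivAt m m' z ∧
      ∀ i j, m' (EuclideanSpace.single j 1) i = α * (σ ^ 2)⁻¹ * V z i j := fun z => by
    obtain ⟨M', hM1, hM2⟩ := exists_hasFDerivAt_integral_gaussianKernel (μ := μ) c α hσ0
      hid hsq z
    have hinv := (hasFDerivAt_inv (hp0 z)).comp z (hp' z)
    have hmul := (hinv.smul hM1).congr_of_eventuallyEq
      (Filter.Eventually.of_forall hmM)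
    refine ⟨_, hmul, fun i j => ?_⟩
    have hcoord : (∫ x, gaussianKernel c α σ z x •
        inner ℝ x (EuclideanSpace.single j (1 : ℝ)) • x ∂μ) i
        = ∫ x, K z x * (x i * x j) ∂μ := by
      have hint := integrable_gaussianKernel_smul c α σ z
        (integrable_inner_smul hid hsq (EuclideanSpace.single j (1 : ℝ)))
      refine ((EuclideanSpace.proj (𝕜 := ℝ) i).integral_comp_comm hint).symm.trans ?_
      refine integral_congr_ae (Filter.Eventually.of_forall fun x => ?_)
      simp [hKG, EuclideanSpace.inner_single_right, mul_comm (x i)]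
    have := hp0 z
    have hMi : M z i = p z * m z i := by
      rw [hmM]
      simp [this]
    have hMz : ∫ x, gaussianKernel c α σ z x • x ∂μ = M z := rfl
    have hM3 : M' (EuclideanSpace.single j 1) i = (σ ^ 2)⁻¹ *
        (α * ∫ x, K z x * (x i * x j) ∂μ - z j * M z i) := by
      rw [hM2, PiLp.smul_apply, PiLp.sub_apply, PiLp.smul_apply, PiLp.smul_apply, hcoord, hMz]
      simp [EuclideanSpace.inner_single_right]
    simp [hM3, hV, hMz, hMi, EuclideanSpace.inner_single_right]
    field_simp
    ring
  have hhess : ∀ z, DifferentiableAt ℝ (gradient fun z => Real.log (p z)) z ∧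
      ∀ i j, fderiv ℝ (gradient fun z => Real.log (p z)) z (EuclideanSpace.single j 1) i
        = α ^ 2 / σ ^ 4 * V z i j - (if i = j then (σ ^ 2)⁻¹ else 0) := fun z => by
    obtain ⟨m', h1, h2⟩ := hm' z
    have h3 : HasFDerivAt (gradient fun z => Real.log (p z))
        ((σ ^ 2)⁻¹ • (α • m' - ContinuousLinearMap.id ℝ _)) z := by
      rw [hgrad]
      exact ((h1.fun_const_smul α).fun_sub (hasFDerivAt_id z)).fun_const_smul _
    refine ⟨h3.differentiableAt, fun i j => ?_⟩
    rw [h3.fderiv]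
    simp [h2, mul_sub]
    field_simp
  refine ⟨fun z => (hlog z).differentiableAt, fun z => (hhess z).1, fun z => (hhess z).2,
    fun z i j => ?_⟩
  rw [(hhess z).2]
  split_ifs <;> field_simp <;> ring
end

section
/- Fix x⁰ ∈ ℝⁿ, real numbers α, β, γ with γ > 0 and real numbers α', β', γ' (the time derivatives of the interpolant coefficients at a fixed time t) satisfying β' γ − β γ' ≠ 0. Let ρ be a probability measure on ℝⁿ with finite first moment, and define the density p(x_t) = ∫ (2πγ²)^{−n/2} exp(−‖x_t − α x⁰ − β x₁‖²/(2γ²)) dρ(x₁), the posterior mean m₁(x_t) = p(x_t)^{−1} ∫ x₁ (2πγ²)^{−n/2} exp(−‖x_t − α x⁰ − β x₁‖²/(2γ²)) dρ(x₁), and the velocity b(x_t) = α' x⁰ + β' m₁(x_t) + (γ'/γ)(x_t − α x⁰ − β m₁(x_t)). Then for every x_t ∈ ℝⁿ, ∇_{x_t} log p(x_t) = ((α β' − α' β) x⁰ − β' x_t + β b(x_t)) / (γ (β' γ − β γ')). -/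
open MeasureTheory Real

/-- The gradient of an isotropic Gaussian bump of height `C` centred at `y`. -/
lemma hasGradientAt_gaussian_bump {E : Type*} [NormedAddCommGroup E] [InnerProductSpace ℝ E]
    [CompleteSpace E] (C γ : ℝ) (y z : E) :
    HasGradientAt (fun z => C * Real.exp (-‖z - y‖ ^ 2 / (2 * γ ^ 2)))
      (-(γ ^ 2)⁻¹ • (C * Real.exp (-‖z - y‖ ^ 2 / (2 * γ ^ 2))) • (z - y)) z := by
  rw [hasGradientAt_iff_hasFDerivAt]
  have h := ((((hasFDerivAt_id z).sub_const y).norm_sq.neg.mul_const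
    (2 * γ ^ 2)⁻¹).exp).const_mul C
  refine h.congr_fderiv ?_
  ext v
  simp [div_eq_mul_inv]
  ring

/-- The gradient of a mixture of isotropic Gaussian bumps, whose centres are `c + β • y` for `y`
distributed according to a finite measure with finite first moment. -/
lemma hasGradientAt_integral_gaussian_bump {E : Type*} [NormedAddCommGroup E]
    [InnerProductSpace ℝ E] [CompleteSpace E] [SecondCountableTopology E] [MeasurableSpace E]
    [BorelSpace E] (ρ : Measure E) [IsFiniteMeasure ρ] (hρ : Integrable (fun x => ‖x‖) ρ)
    {C : ℝ} (hC : 0 ≤ C) (γ β : ℝ) (c z₀ : E) :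
    HasGradientAt (fun z => ∫ y, C * Real.exp (-‖z - c - β • y‖ ^ 2 / (2 * γ ^ 2)) ∂ρ)
      (∫ y, -(γ ^ 2)⁻¹ • (C * Real.exp (-‖z₀ - c - β • y‖ ^ 2 / (2 * γ ^ 2))) •
        (z₀ - c - β • y) ∂ρ) z₀ := by
  have hle (z y : E) : ‖C * Real.exp (-‖z - c - β • y‖ ^ 2 / (2 * γ ^ 2))‖ ≤ C := by
    rw [Real.norm_of_nonneg (by positivity)]
    refine mul_le_of_le_one_right hC (Real.exp_le_one_iff.2 ?_)
    exact div_nonpos_of_nonpos_of_nonneg (by simp) (by positivity)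
  set v : E → E → E := fun z y =>
    -(γ ^ 2)⁻¹ • (C * Real.exp (-‖z - c - β • y‖ ^ 2 / (2 * γ ^ 2))) • (z - c - β • y)
  set B : E → ℝ := fun y => (γ ^ 2)⁻¹ * (C * (1 + ‖z₀ - c‖ + |β| * ‖y‖))
  have hB : Integrable B ρ :=
    (((integrable_const _).add (hρ.const_mul _)).const_mul _).const_mul _
  have hvB : ∀ y, ∀ z ∈ Metric.ball z₀ 1, ‖v z y‖ ≤ B y := by
    intro y z hz
    rw [norm_smul, norm_smul, norm_neg, Real.norm_of_nonneg (by positivity : 0 ≤ (γ ^ 2)⁻¹)]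
    have hzy : ‖z - c - β • y‖ ≤ 1 + ‖z₀ - c‖ + |β| * ‖y‖ := by
      rw [Metric.mem_ball, dist_eq_norm] at hz
      calc ‖z - c - β • y‖ = ‖(z - z₀) + (z₀ - c) - β • y‖ := by congr 1; abel
        _ ≤ ‖z - z₀‖ + ‖z₀ - c‖ + ‖β • y‖ :=
          (norm_sub_le _ _).trans (by gcongr; exact norm_add_le _ _)
        _ ≤ 1 + ‖z₀ - c‖ + |β| * ‖y‖ := by
          rw [norm_smul, Real.norm_eq_abs]
          gcongr
    exact mul_le_mul_of_nonneg_left (mul_le_mul (hle z y) hzy (norm_nonneg _) hC) (by positivity)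
  have hv_cont : Continuous (v z₀) := by fun_prop
  have hv_int : Integrable (v z₀) ρ :=
    hB.mono' hv_cont.aestronglyMeasurable
      (.of_forall fun y => hvB y z₀ (Metric.mem_ball_self one_pos))
  have hv_dual : InnerProductSpace.toDual ℝ E (∫ y, v z₀ y ∂ρ)
      = ∫ y, InnerProductSpace.toDual ℝ E (v z₀ y) ∂ρ :=
    ((innerSL ℝ).integral_comp_commSL (by simp) hv_int).symm
  rw [hasGradientAt_iff_hasFDerivAt, hv_dual]
  refine hasFDerivAt_integral_of_dominated_of_fderiv_le
    (F' := fun z y => InnerProductSpace.toDual ℝ E (v z y))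
    (Metric.ball_mem_nhds z₀ one_pos) ?_ ?_ ?_ ?_ hB ?_
  · exact .of_forall fun z => Continuous.aestronglyMeasurable (by fun_prop)
  · exact .of_bound (Continuous.aestronglyMeasurable (by fun_prop)) C (.of_forall (hle z₀))
  · exact ((InnerProductSpace.toDual ℝ E).continuous.comp hv_cont).aestronglyMeasurable
  · refine .of_forall fun y z hz => ?_
    rw [LinearIsometryEquiv.norm_map]
    exact hvB y z hz
  · refine .of_forall fun y z _ => ?_
    have h := hasGradientAt_gaussian_bump C γ (c + β • y) z
    simpa only [← sub_sub] using h.hasFDerivAt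

/-- **Score–velocity relation for linear stochastic interpolants.** Fix `x⁰ ∈ ℝⁿ`,
coefficients `α, β, γ` with `γ > 0` and their time derivatives `α', β', γ'` satisfying
`β'γ − βγ' ≠ 0`. Let `ρ` be a probability measure on `ℝⁿ` with finite first moment, and
define the conditional density
`p(x_t) = ∫ (2πγ²)^(−n/2) exp(−‖x_t − αx⁰ − βx₁‖²/(2γ²)) dρ(x₁)`, the posterior mean
`m₁(x_t) = p(x_t)⁻¹ ∫ x₁ (2πγ²)^(−n/2) exp(−‖x_t − αx⁰ − βx₁‖²/(2γ²)) dρ(x₁)` and the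
velocity `b(x_t) = α'x⁰ + β'm₁(x_t) + (γ'/γ)(x_t − αx⁰ − βm₁(x_t))`. Then for every `x_t`,
`∇ log p(x_t) = ((αβ' − α'β)x⁰ − β'x_t + βb(x_t)) / (γ(β'γ − βγ'))`. -/
theorem interpolant_score_velocity_relation
    (n : ℕ) (x₀ : EuclideanSpace ℝ (Fin n))
    (α β γ α' β' γ' : ℝ) (hγ : 0 < γ) (hβγ : β' * γ - β * γ' ≠ 0)
    (ρ : Measure (EuclideanSpace ℝ (Fin n))) [IsProbabilityMeasure ρ]
    (hρ1 : Integrable (fun x => ‖x‖) ρ)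
    (p : EuclideanSpace ℝ (Fin n) → ℝ)
    (hp : ∀ xt, p xt =
      ∫ x₁, (2 * π * γ ^ 2) ^ (-(n : ℝ) / 2) *
        Real.exp (-‖xt - α • x₀ - β • x₁‖ ^ 2 / (2 * γ ^ 2)) ∂ρ)
    (m₁ : EuclideanSpace ℝ (Fin n) → EuclideanSpace ℝ (Fin n))
    (hm₁ : ∀ xt, m₁ xt = (p xt)⁻¹ •
      ∫ x₁, ((2 * π * γ ^ 2) ^ (-(n : ℝ) / 2) *
        Real.exp (-‖xt - α • x₀ - β • x₁‖ ^ 2 / (2 * γ ^ 2))) • x₁ ∂ρ)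
    (b : EuclideanSpace ℝ (Fin n) → EuclideanSpace ℝ (Fin n))
    (hb : ∀ xt, b xt = α' • x₀ + β' • m₁ xt
      + (γ' / γ) • (xt - α • x₀ - β • m₁ xt)) :
    ∀ xt, gradient (fun z => Real.log (p z)) xt
      = (γ * (β' * γ - β * γ'))⁻¹ •
          ((α * β' - α' * β) • x₀ - β' • xt + β • b xt) := by
  intro xt
  set C : ℝ := (2 * π * γ ^ 2) ^ (-(n : ℝ) / 2)
  have hC : 0 < C := by positivity
  set K : EuclideanSpace ℝ (Fin n) → ℝ := fun y =>
    C * Real.exp (-‖xt - α • x₀ - β • y‖ ^ 2 / (2 * γ ^ 2))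
  have hK_pos (y) : 0 < K y := by positivity
  have hK_le (y) : ‖K y‖ ≤ C := by
    rw [Real.norm_of_nonneg (hK_pos y).le]
    refine mul_le_of_le_one_right hC.le (Real.exp_le_one_iff.2 ?_)
    exact div_nonpos_of_nonpos_of_nonneg (by simp) (by positivity)
  have hK_meas : AEStronglyMeasurable K ρ := Continuous.aestronglyMeasurable (by fun_prop)
  have hK_int : Integrable K ρ := .of_bound hK_meas C (.of_forall hK_le)
  have hKy_int : Integrable (fun y => K y • y) ρ :=
    ((integrable_norm_iff (by fun_prop)).1 hρ1).bdd_smul C hK_meas (.of_forall hK_le)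
  have hp_pos : 0 < p xt := by
    rw [hp, integral_pos_iff_support_of_nonneg (fun y => (hK_pos y).le) hK_int,
      Function.support_eq_univ (fun y => (hK_pos y).ne')]
    simp
  have hm : ∫ y, K y • y ∂ρ = p xt • m₁ xt := by
    rw [hm₁, smul_inv_smul₀ hp_pos.ne']
  have hgrad : HasGradientAt p
      (-(γ ^ 2)⁻¹ • p xt • (xt - α • x₀ - β • m₁ xt)) xt := by
    have h := hasGradientAt_integral_gaussian_bump ρ hρ1 hC.le γ β (α • x₀) xt
    rw [← funext hp, integral_smul] at h
    convert h using 2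
    calc p xt • (xt - α • x₀ - β • m₁ xt)
        = p xt • (xt - α • x₀) - β • ∫ y, K y • y ∂ρ := by
          rw [hm, smul_sub, smul_comm β]
      _ = ∫ y, K y • (xt - α • x₀ - β • y) ∂ρ := by
          simp_rw [smul_sub (K _) (xt - α • x₀), smul_comm (K _) β]
          rw [integral_sub (hK_int.smul_const _) (by exact hKy_int.smul β), integral_smul_const,
            integral_smul, hp]
  have hlog : HasGradientAt (fun z => Real.log (p z))
      (-(γ ^ 2)⁻¹ • (xt - α • x₀ - β • m₁ xt)) xt := by
    rw [hasGradientAt_iff_hasFDerivAt]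
    refine (hgrad.hasFDerivAt.log hp_pos.ne').congr_fderiv ?_
    rw [← map_smul, smul_comm _ (p xt), inv_smul_smul₀ hp_pos.ne']
  rw [hlog.gradient, hb, eq_inv_smul_iff₀ (mul_ne_zero hγ.ne' hβγ)]
  match_scalars <;> field_simp <;> ring
end
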